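/- Let G and G' be finitely generated Abelian groups. If the sets of growth functions with respect to finite monoid generating sets coincide, i.e. { β_{G,S} : S a finite monoid generating set of G } = { β_{G',S'} : S' a finite monoid generating set of G' }, then rk G = rk G' and |tors G| = |tors G'|. -/

import Mathlib

/-- `S` is a monoid generating set of the group `G`: every element of `G` is a
product of finitely many elements of `S`. -/
def IsMonGenSet {G : Type*} [Group G] (S : Set G) : Prop := Submonoid.closure S = ⊤

/-- `S` is symmetric: closed under inverses. -/
def IsSymmSet {G : Type*} [Group G] (S : Set G) : Prop := ∀ s ∈ S, s⁻¹ ∈ S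

/-- The word length of `g` with respect to `S`: the least `n` such that `g` is a
product of `n` elements of `S`. -/
noncomputable def wlen {G : Type*} [Group G] (S : Set G) (g : G) : ℕ :=
  sInf {n | ∃ l : List G, (∀ x ∈ l, x ∈ S) ∧ l.length = n ∧ l.prod = g}

/-- The growth function `β_{G,S}`: the cardinality of the ball of radius `r`. -/
noncomputable def growth {G : Type*} [Group G] (S : Set G) (r : ℕ) : ℕ :=
  Set.ncard {g : G | wlen S g ≤ r}

/-- The spherical growth function `σ_{G,S}`. -/
noncomputable def sph {G : Type*} [Group G] (S : Set G) (r : ℕ) : ℕ :=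
  Set.ncard {g : G | wlen S g = r}

/-- The standard symmetric generating set `E_d ∪ (-E_d)` of `ℤ^d`. -/
def stdSymmSet (d : ℕ) : Set (Multiplicative (Fin d → ℤ)) :=
  {x | ∃ i : Fin d, x = Multiplicative.ofAdd (Pi.single i 1) ∨
       x = Multiplicative.ofAdd (-Pi.single i 1)}

/-- The standard symmetric growth function `β_d` of `ℤ^d`. -/
noncomputable def betaStd (d : ℕ) : ℕ → ℕ := growth (stdSymmSet d)

/-- The standard monoid generating set `E_d ∪ {v_d}` of `ℤ^d`. -/
def stdMonSet (d : ℕ) : Set (Multiplicative (Fin d → ℤ)) :=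
  {x | (∃ i : Fin d, x = Multiplicative.ofAdd (Pi.single i 1)) ∨
       x = Multiplicative.ofAdd (fun _ => (-1 : ℤ))}

/-- The standard monoid growth function `β⁺_d` of `ℤ^d`. -/
noncomputable def betaPlus (d : ℕ) : ℕ → ℕ := growth (stdMonSet d)

/-- The rank of a finitely generated abelian group. -/
noncomputable def rk (G : Type*) [CommGroup G] : ℕ := Module.finrank ℤ (Additive G)

open Finset in
/-- Tuples of naturals with sum at most `r`. -/
def simplexTuples (d r : ℕ) : Finset (Fin d → ℕ) :=
  {n ∈ Fintype.piFinset fun _ => range (r + 1) | ∑ i, n i ≤ r}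

theorem mem_simplexTuples {d r : ℕ} {n : Fin d → ℕ} :
    n ∈ simplexTuples d r ↔ ∑ i, n i ≤ r := by
  simp only [simplexTuples, Finset.mem_filter, Fintype.mem_piFinset, Finset.mem_range,
    and_iff_right_iff_imp]
  intro h i
  have := Finset.single_le_sum (f := n) (fun _ _ => Nat.zero_le _) (Finset.mem_univ i)
  omega

theorem card_simplexTuples (d r : ℕ) : (simplexTuples d r).card = (r + d).choose d := by
  classical
  have h1 : (Finset.piAntidiag (Finset.univ : Finset (Option (Fin d))) r).card
      = (r + d).choose d := by
    rw [← Finset.map_sym_eq_piAntidiag, Finset.card_map, Finset.sym_univ, Finset.card_univ,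
      Sym.card_sym_eq_choose, Fintype.card_option, Fintype.card_fin,
      show d + 1 + r - 1 = r + d by omega, Nat.choose_symm_add]
  rw [← h1]
  refine Finset.card_bij' (fun n _ o => o.elim (r - ∑ i, n i) n) (fun m _ j => m (some j))
    ?_ ?_ ?_ ?_
  · intro n hn
    rw [mem_simplexTuples] at hn
    simp [Fintype.sum_option, hn]
  · intro m hm
    rw [mem_simplexTuples]
    simp [Fintype.sum_option] at hm
    omega
  · intro n _
    rfl
  · intro m hm
    simp [Fintype.sum_option] at hm
    funext o
    cases o <;> simp
    omega

open Filter Asymptotics in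
theorem le_of_forall_mul_choose_le {a b c d d' : ℕ} (ha : 0 < a)
    (h : ∀ r, a * (r + d').choose d' ≤ b * (r + c + d).choose d) :
    d' ≤ d ∧ (d' = d → a ≤ b) := by
  have hup : ∀ r : ℕ, ((r:ℝ) + 1) ^ d' * (a * d.factorial) ≤
      ((r:ℝ) + (c + d)) ^ d * (b * d'.factorial) := by
    intro r
    have h1 := Nat.pow_le_choose (α := ℝ) d' (r + d')
    have h2 := Nat.choose_le_pow_div (α := ℝ) d (r + c + d)
    have h3 : (a:ℝ) * (r + d').choose d' ≤ b * (r + c + d).choose d := by exact_mod_cast h r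
    rw [show r + d' + 1 - d' = r + 1 by omega, div_le_iff₀ (by positivity)] at h1
    rw [le_div_iff₀ (by positivity)] at h2
    push_cast at h1 h2
    have h1' := mul_le_mul_of_nonneg_right h1 (show (0:ℝ) ≤ a * d.factorial by positivity)
    have h2' := mul_le_mul_of_nonneg_right h2 (show (0:ℝ) ≤ b * d'.factorial by positivity)
    have h3' := mul_le_mul_of_nonneg_right h3
      (show (0:ℝ) ≤ d.factorial * d'.factorial by positivity)
    rw [← add_assoc]
    linarith
  have hlim : Tendsto (fun r : ℕ => ((r:ℝ) + (c + d)) / (r + 1)) atTop (nhds 1) := by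
    have h1 : Tendsto (fun r : ℕ => 1 + ((c:ℝ) + d - 1) * (1 / ((r:ℝ) + 1))) atTop
        (nhds (1 + ((c:ℝ) + d - 1) * 0)) :=
      (tendsto_one_div_add_atTop_nhds_zero_nat.const_mul _).const_add _
    rw [mul_zero, add_zero] at h1
    refine h1.congr fun r => ?_
    field_simp
    ring
  have hlimd := (hlim.pow d).mul_const ((b:ℝ) * d'.factorial)
  rw [one_pow, one_mul] at hlimd
  have key : ∀ e : ℕ, d + e ≤ d' → ∀ r : ℕ, ((r:ℝ) + 1) ^ e * (a * d.factorial) ≤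
      (((r:ℝ) + (c + d)) / (r + 1)) ^ d * (b * d'.factorial) := by
    intro e he r
    rw [div_pow, div_mul_eq_mul_div, le_div_iff₀ (by positivity)]
    refine le_trans ?_ (hup r)
    rw [mul_right_comm, ← pow_add]
    gcongr
    · linarith [Nat.cast_nonneg (α := ℝ) r]
    · omega
  constructor
  · by_contra! hd
    have ht : Tendsto (fun r : ℕ => ((r:ℝ) + 1) ^ 1 * (a * d.factorial)) atTop atTop := by
      simp only [pow_one]
      refine Tendsto.atTop_mul_const (by positivity) ?_
      exact tendsto_atTop_add_const_right _ _ tendsto_natCast_atTop_atTop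
    exact not_tendsto_atTop_of_tendsto_nhds hlimd
      (tendsto_atTop_mono (key 1 (by omega)) ht)
  · rintro rfl
    have h0 := key 0 (by omega)
    simp only [pow_zero, one_mul] at h0
    have h1 := ge_of_tendsto' hlimd h0
    have := le_of_mul_le_mul_right h1 (by positivity)
    exact_mod_cast this

theorem exists_hom_int_pi {G : Type*} [CommGroup G] (hG : Group.FG G) (d : ℕ)
    (hd : Module.finrank ℤ (Additive G) = d) :
    ∃ p : Additive G →+ (Fin d → ℤ), Function.Surjective p ∧
      (∀ g : G, p (Additive.ofMul g) = 0 ↔ g ∈ CommGroup.torsion G) ∧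
      Finite (CommGroup.torsion G) := by
  have : AddGroup.FG (Additive G) := inferInstance
  have : Module.Finite ℤ (Additive G) := Module.Finite.iff_addGroup_fg.mpr this
  let q := Additive G ⧸ Submodule.torsion ℤ (Additive G)
  have : Module.Free ℤ q := inferInstance
  have hq : Module.finrank ℤ q = d := by
    rw [← hd]; exact finrank_quotient_eq_of_le_torsion le_rfl
  let b := Module.finBasisOfFinrankEq ℤ q hq
  have hmem : ∀ g : G, Additive.ofMul g ∈ Submodule.torsion ℤ (Additive G) ↔
      g ∈ CommGroup.torsion G := by
    intro g
    rw [← Submodule.mem_toAddSubgroup, Submodule.torsion_int]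
    exact isOfFinAddOrder_ofMul_iff
  refine ⟨(b.equivFun.toLinearMap ∘ₗ Submodule.mkQ _).toAddMonoidHom, ?_, ?_, ?_⟩
  · exact b.equivFun.surjective.comp (Submodule.mkQ_surjective _)
  · intro g
    rw [← hmem, ← Submodule.Quotient.mk_eq_zero]
    exact b.equivFun.map_eq_zero_iff
  · have : Finite (Submodule.torsion ℤ (Additive G)) :=
      Module.finite_of_fg_torsion _ (Submodule.torsion_isTorsion)
    exact Finite.of_injective
      (fun x : CommGroup.torsion G =>
        (⟨Additive.ofMul x.1, (hmem _).2 x.2⟩ : Submodule.torsion ℤ (Additive G)))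
      (fun x y h => Subtype.ext (by simpa using h))

section WordLength

variable {G : Type*} [CommGroup G] {S : Set G}

theorem wlen_list_prod_le {l : List G} (hl : ∀ x ∈ l, x ∈ S) : wlen S l.prod ≤ l.length :=
  Nat.sInf_le ⟨l, hl, rfl, rfl⟩

theorem IsMonGenSet.exists_list (hS : IsMonGenSet S) (g : G) :
    ∃ l : List G, (∀ x ∈ l, x ∈ S) ∧ l.length = wlen S g ∧ l.prod = g := by
  have hg : g ∈ Submonoid.closure S := hS ▸ Submonoid.mem_top g
  obtain ⟨l, hl, hp⟩ := Submonoid.exists_list_of_mem_closure hg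
  exact Nat.sInf_mem (s := {n | ∃ l : List G, (∀ x ∈ l, x ∈ S) ∧ l.length = n ∧ l.prod = g})
    ⟨l.length, l, hl, rfl, hp⟩

theorem IsMonGenSet.wlen_mul_le (hS : IsMonGenSet S) (g h : G) :
    wlen S (g * h) ≤ wlen S g + wlen S h := by
  obtain ⟨l, hl, hlen, rfl⟩ := hS.exists_list g
  obtain ⟨l', hl', hlen', rfl⟩ := hS.exists_list h
  rw [← hlen, ← hlen', ← List.length_append, ← List.prod_append]
  refine wlen_list_prod_le fun x hx => ?_
  rcases List.mem_append.1 hx with hx | hx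
  exacts [hl x hx, hl' x hx]

theorem wlen_pow_le {s : G} (hs : s ∈ S) (n : ℕ) : wlen S (s ^ n) ≤ n := by
  simpa using wlen_list_prod_le (S := S) (l := List.replicate n s)
    (fun x hx => List.eq_of_mem_replicate hx ▸ hs)

theorem IsMonGenSet.wlen_prod_pow_le (hS : IsMonGenSet S) {ι : Type*} (I : Finset ι)
    {w : ι → G} (hw : ∀ i, w i ∈ S) (n : ι → ℕ) :
    wlen S (∏ i ∈ I, w i ^ n i) ≤ ∑ i ∈ I, n i := by
  classical
  induction I using Finset.induction_on with
  | empty => simpa using wlen_list_prod_le (S := S) (l := []) (by simp)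
  | insert a I ha ih =>
    rw [Finset.prod_insert ha, Finset.sum_insert ha]
    exact (hS.wlen_mul_le _ _).trans (add_le_add (wlen_pow_le (hw a) _) ih)

theorem IsMonGenSet.finite_ball (hS : IsMonGenSet S) (hfin : S.Finite) (r : ℕ) :
    {g : G | wlen S g ≤ r}.Finite := by
  have : Finite S := hfin
  refine ((List.finite_length_le S r).image fun l => (l.map Subtype.val).prod).subset ?_
  intro g hg
  obtain ⟨l, hl, hlen, rfl⟩ := hS.exists_list g
  lift l to List S using hl
  exact ⟨l, by simpa using hlen.trans_le hg, rfl⟩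

end WordLength

theorem exists_consistent_choice {ι α : Type*} {S : Set α} (P : ι → α → Prop)
    (h : ∀ i, ∃ s ∈ S, P i s) :
    ∃ t : ι → α, (∀ i, t i ∈ S ∧ P i (t i)) ∧
      ∀ i j, t i = t j ∨ ¬ P j (t i) ∨ ¬ P i (t j) := by
  have wf : WellFounded (WellOrderingRel (α := α)) := WellOrderingRel.isWellOrder.wf
  let A : ι → Set α := fun i => {s | s ∈ S ∧ P i s}
  have hA : ∀ i, (A i).Nonempty := h
  have hmem : ∀ i, wf.min (A i) (hA i) ∈ A i := fun i => wf.min_mem _ _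
  refine ⟨fun i => wf.min (A i) (hA i), hmem, fun i j => ?_⟩
  rcases trichotomous_of WellOrderingRel (wf.min (A i) (hA i)) (wf.min (A j) (hA j))
    with hlt | heq | hlt
  · exact Or.inr (Or.inl fun hP => wf.not_lt_min (A j) ⟨(hmem i).1, hP⟩ hlt)
  · exact Or.inl heq
  · exact Or.inr (Or.inr fun hP => wf.not_lt_min (A i) ⟨(hmem j).1, hP⟩ hlt)

section LowerBound

variable {G : Type*} [CommGroup G] {d : ℕ} {S : Set G}

theorem IsMonGenSet.exists_dual_system (hS : IsMonGenSet S) {p : Additive G →+ (Fin d → ℤ)}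
    (hp : Function.Surjective p) :
    ∃ (s : Fin d → G) (φ : Fin d → Additive G →+ ℚ), (∀ i, s i ∈ S) ∧
      (∀ k i, φ k (Additive.ofMul (s i)) = if i = k then 1 else 0) ∧
      ∀ k g, p g = 0 → φ k g = 0 := by
  let v : Additive G →+ (Fin d → ℚ) := ((Int.castAddHom ℚ).compLeft (Fin d)).comp p
  let W : Submodule ℚ (Fin d → ℚ) := Submodule.span ℚ ((fun g => v (Additive.ofMul g)) '' S)
  have hv : ∀ g : G, v (Additive.ofMul g) ∈ W := by
    intro g
    have hg : g ∈ Submonoid.closure S := hS ▸ Submonoid.mem_top g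
    induction hg using Submonoid.closure_induction with
    | mem x hx => exact Submodule.subset_span ⟨x, hx, rfl⟩
    | one => simp
    | mul x y _ _ hx hy => rw [ofMul_mul, map_add]; exact W.add_mem hx hy
  have hW : W = ⊤ := by
    rw [eq_top_iff, ← (Pi.basisFun ℚ (Fin d)).span_eq, Submodule.span_le]
    rintro _ ⟨i, rfl⟩
    obtain ⟨g, hg⟩ := hp (Pi.single i 1)
    have h := hv g.toMul
    have hgi : v g = Pi.single i 1 := by
      funext k
      simp [v, hg, Pi.single_apply]
    rw [ofMul_toMul, hgi] at h
    simpa using h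
  obtain ⟨f, hfS, hfspan, hfli⟩ := Submodule.exists_fun_fin_finrank_span_eq ℚ
    ((fun g => v (Additive.ofMul g)) '' S)
  have hrank : Module.finrank ℚ W = d := by rw [hW]; simp
  let b : Module.Basis (Fin d) ℚ (Fin d → ℚ) :=
    (Module.Basis.mk hfli (by rw [hfspan]; exact hW.ge)).reindex (finCongr hrank)
  have hb : ∀ i, ∃ g ∈ S, v (Additive.ofMul g) = b i := by
    intro i
    obtain ⟨g, hg, h⟩ := hfS ((finCongr hrank).symm i)
    refine ⟨g, hg, ?_⟩
    simpa [b] using h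
  choose s hsS hs using hb
  refine ⟨s, fun k => (b.coord k).toAddMonoidHom.comp v, hsS, fun k i => ?_, fun k g hg => ?_⟩
  · simp [hs, Finsupp.single_apply]
  · simp [v, hg]

/-- Exchanging one vector of a dual basis `s` at a time for an element of `t` yields `d + 1`
simplicial cones with disjoint interiors; this is the resulting family of generators. -/
def coneGen (s t : Fin d → G) : Option (Fin d) → Fin d → G
  | none => s
  | some i => Function.update s i (t i)

theorem coneGen_mem {G : Type*} {S : Set G} {d : ℕ} {s t : Fin d → G} (hs : ∀ i, s i ∈ S) (ht : ∀ i, t i ∈ S)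
    (o : Option (Fin d)) (j : Fin d) : coneGen s t o j ∈ S := by
  cases o with
  | none => exact hs j
  | some i =>
    by_cases h : j = i
    · subst h; simpa [coneGen] using ht j
    · simpa [coneGen, h] using hs j

variable {s t : Fin d → G} {φ : Fin d → Additive G →+ ℚ}

theorem apply_prod_coneGen_none
    (hφ : ∀ k i, φ k (Additive.ofMul (s i)) = if i = k then 1 else 0) (n : Fin d → ℕ)
    (k : Fin d) : φ k (Additive.ofMul (∏ j, coneGen s t none j ^ n j)) = n k := by
  simp [coneGen, ofMul_prod, hφ]

theorem apply_prod_coneGen_some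
    (hφ : ∀ k i, φ k (Additive.ofMul (s i)) = if i = k then 1 else 0) (n : Fin d → ℕ)
    (i k : Fin d) : φ k (Additive.ofMul (∏ j, coneGen s t (some i) j ^ n j)) =
      (if k = i then 0 else (n k : ℚ)) + n i * φ k (Additive.ofMul (t i)) := by
  have h : ∀ j, (n j : ℚ) * φ k (Additive.ofMul (coneGen s t (some i) j)) =
      (if j = k then (if k = i then 0 else (n k : ℚ)) else 0) +
        if j = i then n i * φ k (Additive.ofMul (t i)) else 0 := by
    intro j
    by_cases hji : j = i
    · subst hji
      by_cases hjk : j = k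
      · subst hjk; simp [coneGen]
      · simp [coneGen, hjk]
    · by_cases hjk : j = k
      · subst hjk; simp [coneGen, hji, hφ]
      · simp [coneGen, hji, hjk, hφ]
  simp [ofMul_prod, h, Finset.sum_add_distrib]

theorem coneGen_coords_injective
    (hφ : ∀ k i, φ k (Additive.ofMul (s i)) = if i = k then 1 else 0)
    (ht : ∀ i, φ i (Additive.ofMul (t i)) < 0)
    (htt : ∀ i j, t i = t j ∨ ¬ φ j (Additive.ofMul (t i)) < 0 ∨
      ¬ φ i (Additive.ofMul (t j)) < 0)
    {o o' : Option (Fin d)} {n n' : Fin d → ℕ} (hn : ∀ j, 0 < n j) (hn' : ∀ j, 0 < n' j)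
    (h : ∀ k, φ k (Additive.ofMul (∏ j, coneGen s t o j ^ n j)) =
      φ k (Additive.ofMul (∏ j, coneGen s t o' j ^ n' j))) : o = o' ∧ n = n' := by
  have pos : ∀ j, (0 : ℚ) < n j := fun j => by exact_mod_cast hn j
  have pos' : ∀ j, (0 : ℚ) < n' j := fun j => by exact_mod_cast hn' j
  cases o with
  | none =>
    cases o' with
    | none =>
      refine ⟨rfl, funext fun k => ?_⟩
      have hk := h k
      rw [apply_prod_coneGen_none hφ, apply_prod_coneGen_none hφ] at hk
      exact_mod_cast hk
    | some i =>
      have hi := h i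
      rw [apply_prod_coneGen_none hφ, apply_prod_coneGen_some hφ, if_pos rfl, zero_add] at hi
      nlinarith [pos i, mul_neg_of_pos_of_neg (pos' i) (ht i)]
  | some i =>
    cases o' with
    | none =>
      have hi := h i
      rw [apply_prod_coneGen_none hφ, apply_prod_coneGen_some hφ, if_pos rfl, zero_add] at hi
      nlinarith [pos' i, mul_neg_of_pos_of_neg (pos i) (ht i)]
    | some i' =>
      simp only [apply_prod_coneGen_some hφ] at h
      by_cases hii : i = i'
      · subst hii
        have hi := h i
        simp only [if_true, zero_add] at hi
        have hni := mul_right_cancel₀ (ht i).ne hi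
        refine ⟨rfl, funext fun k => ?_⟩
        by_cases hk : k = i
        · subst hk; exact_mod_cast hni
        · have := h k
          rw [if_neg hk, if_neg hk, hni] at this
          exact_mod_cast add_right_cancel this
      · exfalso
        have hi := h i
        have hi' := h i'
        rw [if_pos rfl, if_neg hii, zero_add] at hi
        rw [if_pos rfl, if_neg (Ne.symm hii), zero_add] at hi'
        have m1 := mul_neg_of_pos_of_neg (pos i) (ht i)
        have m2 := mul_neg_of_pos_of_neg (pos' i') (ht i')
        rcases htt i i' with heq | hge | hge
        · rw [heq] at hi hi'
          have a1 : ((n' i' : ℚ) - n i) * φ i (Additive.ofMul (t i')) < 0 := by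
            linarith [pos' i]
          have a2 : ((n i : ℚ) - n' i') * φ i' (Additive.ofMul (t i')) < 0 := by
            linarith [pos i']
          have b1 := ht i
          rw [heq] at b1
          have c1 := pos_of_mul_neg_left a1 b1.le
          have c2 := pos_of_mul_neg_left a2 (ht i').le
          linarith
        · linarith [mul_nonneg (pos i).le (not_lt.1 hge), pos i']
        · linarith [mul_nonneg (pos' i').le (not_lt.1 hge), pos' i]

theorem IsMonGenSet.exists_le_growth (hS : IsMonGenSet S) (hfin : S.Finite)
    {p : Additive G →+ (Fin d → ℤ)} (hp : Function.Surjective p) (K : Subgroup G) [Finite K]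
    (hK : ∀ g ∈ K, p (Additive.ofMul g) = 0) :
    ∃ c, ∀ r, Nat.card K * (d + 1) * (r + d).choose d ≤ growth S (r + c) := by
  obtain ⟨s, φ, hs, hφ, hφK⟩ := hS.exists_dual_system hp
  have hneg : ∀ i, ∃ x ∈ S, φ i (Additive.ofMul x) < 0 := by
    intro i
    by_contra! hcon
    have hall : ∀ g : G, 0 ≤ φ i (Additive.ofMul g) := by
      intro g
      have hg : g ∈ Submonoid.closure S := hS ▸ Submonoid.mem_top g
      induction hg using Submonoid.closure_induction with
      | mem x hx => exact hcon x hx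
      | one => simp
      | mul x y _ _ hx hy => rw [ofMul_mul, map_add]; exact add_nonneg hx hy
    have := hall (s i)⁻¹
    rw [ofMul_inv, map_neg, hφ, if_pos rfl] at this
    linarith
  obtain ⟨t, ht, htt⟩ := exists_consistent_choice _ hneg
  obtain ⟨m, hm⟩ : ∃ m, ∀ k : K, wlen S (k : G) ≤ m :=
    (Set.finite_range fun k : K => wlen S (k : G)).bddAbove.imp fun m hm k => hm ⟨k, rfl⟩
  refine ⟨d + m, fun r => ?_⟩
  let F : Option (Fin d) × simplexTuples d r × K → G := fun x =>
    (∏ j, coneGen s t x.1 j ^ ((x.2.1 : Fin d → ℕ) j + 1)) * x.2.2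
  have hF : Function.Injective F := by
    rintro ⟨o, n, k⟩ ⟨o', n', k'⟩ h
    have hc := coneGen_coords_injective (o := o) (o' := o') (n := fun j => n.1 j + 1)
      (n' := fun j => n'.1 j + 1) hφ (fun i => (ht i).2) htt (fun _ => Nat.succ_pos _)
      (fun _ => Nat.succ_pos _) (fun l => by
        have := congrArg (fun g => φ l (Additive.ofMul g)) h
        simpa [F, ofMul_mul, hφK l _ (hK _ k.2), hφK l _ (hK _ k'.2)] using this)
    obtain ⟨rfl, hn⟩ := hc
    obtain rfl : n = n' := Subtype.ext (funext fun j => Nat.succ_injective (congrFun hn j))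
    have hk : k = k' := Subtype.ext (mul_left_cancel h)
    rw [hk]
  have hsub : Set.range F ⊆ {g : G | wlen S g ≤ r + (d + m)} := by
    rintro _ ⟨⟨o, n, k⟩, rfl⟩
    have h1 := hS.wlen_prod_pow_le Finset.univ (coneGen_mem hs (fun i => (ht i).1) o)
      (fun j => n.1 j + 1)
    have h2 := mem_simplexTuples.1 n.2
    have h3 := hm k
    rw [Finset.sum_add_distrib] at h1
    simp only [Finset.sum_const, Finset.card_univ, Fintype.card_fin, smul_eq_mul, mul_one] at h1
    refine (hS.wlen_mul_le _ _).trans ?_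
    dsimp only
    omega
  have hcard : (Set.range F).ncard = Nat.card K * (d + 1) * (r + d).choose d := by
    rw [← Set.image_univ, Set.ncard_image_of_injective _ hF, Set.ncard_univ]
    simp only [Nat.card_prod, Nat.card_eq_fintype_card, Fintype.card_option, Fintype.card_fin,
      Fintype.card_coe, card_simplexTuples]
    ring
  rw [← hcard]
  exact Set.ncard_le_ncard hsub (hS.finite_ball hfin _)

end LowerBound

section UpperBound

variable {G : Type*} [CommGroup G] {d : ℕ}

/-- The standard monoid generators `e_i`, `-(e_1 + ⋯ + e_d)` of `ℤ^d`, together with `0`. -/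
def stdMonSetZero (d : ℕ) : Set (Fin d → ℤ) :=
  insert 0 (insert (fun _ => -1) (Set.range fun i => Pi.single i 1))

/-- The point with coordinates `n` in the cone of the standard fan labelled by `o`. -/
def stdConePoint (o : Option (Fin d)) (n : Fin d → ℕ) : Fin d → ℤ :=
  o.elim (fun k => (n k : ℤ)) fun i k => (if k = i then 0 else (n k : ℤ)) - n i

theorem exists_stdConePoint_eq (a : Fin d → ℕ) (m : ℕ) :
    ∃ (o : Option (Fin d)) (n : Fin d → ℕ), ∑ i, n i ≤ ∑ i, a i + m ∧
      stdConePoint o n = fun k => (a k : ℤ) - m := by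
  by_cases h : ∀ i, m ≤ a i
  · refine ⟨none, fun i => a i - m, ?_, ?_⟩
    · exact (Finset.sum_le_sum fun i _ => Nat.sub_le _ _).trans (Nat.le_add_right _ _)
    · funext k
      simp [stdConePoint, h k]
  · push Not at h
    obtain ⟨j, hj⟩ := h
    obtain ⟨i, -, hi⟩ := Finset.exists_min_image Finset.univ a ⟨j, Finset.mem_univ j⟩
    have him : a i < m := (hi j (Finset.mem_univ j)).trans_lt hj
    refine ⟨some i, fun k => if k = i then m - a i else a k - a i, ?_, ?_⟩
    · calc ∑ k, (if k = i then m - a i else a k - a i)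
          ≤ ∑ k, (a k + if k = i then m else 0) :=
            Finset.sum_le_sum fun k _ => by split_ifs <;> omega
        _ = ∑ k, a k + m := by simp [Finset.sum_add_distrib]
    · funext k
      have := hi k (Finset.mem_univ k)
      by_cases hk : k = i
      · subst hk
        simp [stdConePoint]
        omega
      · simp [stdConePoint, hk]
        omega

variable {p : Additive G →+ (Fin d → ℤ)}

theorem exists_apply_list_prod_eq {l : List G}
    (hl : ∀ x ∈ l, p (Additive.ofMul x) ∈ stdMonSetZero d) :
    ∃ (a : Fin d → ℕ) (m : ℕ), ∑ i, a i + m ≤ l.length ∧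
      p (Additive.ofMul l.prod) = fun k => (a k : ℤ) - m := by
  induction l with
  | nil => exact ⟨0, 0, by simp, by funext; simp⟩
  | cons x l ih =>
    obtain ⟨a, m, hlen, h⟩ := ih fun y hy => hl y (List.mem_cons_of_mem _ hy)
    rw [List.prod_cons, ofMul_mul, map_add, h]
    rcases hl x List.mem_cons_self with hx | hx | ⟨i, hx⟩
    · exact ⟨a, m, by simp; omega, by simp [hx]⟩
    · refine ⟨a, m + 1, by simp; omega, ?_⟩
      funext k
      simp [hx]
      ring
    · refine ⟨a + Pi.single i 1, m, ?_, ?_⟩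
      · simp [Finset.sum_add_distrib]
        omega
      · funext k
        simp [← hx, Pi.single_apply]
        ring

theorem isMonGenSet_preimage_stdMonSetZero (hp : Function.Surjective p) :
    IsMonGenSet {g : G | p (Additive.ofMul g) ∈ stdMonSetZero d} := by
  rw [IsMonGenSet, eq_top_iff]
  intro g _
  obtain ⟨σ, hσ⟩ := hp.hasRightInverse
  let m : ℕ := ∑ i, (p (Additive.ofMul g) i).natAbs
  let x : G := (∏ i, (σ (Pi.single i 1)).toMul ^ (p (Additive.ofMul g) i + m).toNat) *
    (σ fun _ => -1).toMul ^ m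
  have hx : p (Additive.ofMul x) = p (Additive.ofMul g) := by
    funext k
    have hk : (p (Additive.ofMul g) k).natAbs ≤ m :=
      Finset.single_le_sum (f := fun i => (p (Additive.ofMul g) i).natAbs)
        (fun _ _ => Nat.zero_le _) (Finset.mem_univ k)
    have hk' : max (p (Additive.ofMul g) k + m) 0 = p (Additive.ofMul g) k + m := by omega
    simp [x, ofMul_mul, ofMul_prod, hσ _, Finset.sum_apply, Pi.single_apply, hk']
  have hxmem : x ∈ Submonoid.closure {g : G | p (Additive.ofMul g) ∈ stdMonSetZero d} := by
    refine mul_mem (prod_mem fun i _ => pow_mem (Submonoid.subset_closure ?_) _)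
      (pow_mem (Submonoid.subset_closure ?_) _)
    · exact Or.inr (Or.inr ⟨i, by simp [hσ _]⟩)
    · exact Or.inr (Or.inl (by simp [hσ _]))
  rw [← mul_inv_cancel_left x g]
  exact mul_mem hxmem (Submonoid.subset_closure (Or.inl (by simp [ofMul_mul, hx])))

theorem exists_growth_le (hp : Function.Surjective p) (K : Subgroup G) [Finite K]
    (hK : ∀ g, p (Additive.ofMul g) = 0 → g ∈ K) :
    ∃ S : Set G, S.Finite ∧ IsMonGenSet S ∧
      ∀ r, growth S r ≤ Nat.card K * (d + 1) * (r + d).choose d := by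
  obtain ⟨σ, hσ⟩ := hp.hasRightInverse
  have hdecomp : ∀ g : G, ∃ k : K, g = (σ (p (Additive.ofMul g))).toMul * k := fun g =>
    ⟨⟨(σ (p (Additive.ofMul g))).toMul⁻¹ * g, hK _ (by simp [ofMul_mul, hσ _])⟩, by simp⟩
  have hgen := isMonGenSet_preimage_stdMonSetZero hp
  refine ⟨_, ?_, hgen, fun r => ?_⟩
  · have hU : (stdMonSetZero d).Finite := ((Set.finite_range _).insert _).insert _
    refine ((hU.prod (Set.finite_univ (α := K))).image fun x => (σ x.1).toMul * (x.2 : G)).subset ?_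
    intro g hg
    obtain ⟨k, hk⟩ := hdecomp g
    exact ⟨(p (Additive.ofMul g), k), ⟨hg, trivial⟩, hk.symm⟩
  · let F : Option (Fin d) × simplexTuples d r × K → G := fun x =>
      (σ (stdConePoint x.1 x.2.1)).toMul * x.2.2
    have hsub : {g : G | wlen {g : G | p (Additive.ofMul g) ∈ stdMonSetZero d} g ≤ r} ⊆
        F '' Set.univ := by
      intro g hg
      obtain ⟨l, hl, hlen, hprod⟩ := hgen.exists_list g
      obtain ⟨a, m, ham, h⟩ := exists_apply_list_prod_eq hl
      obtain ⟨o, n, hn, hon⟩ := exists_stdConePoint_eq a m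
      obtain ⟨k, hk⟩ := hdecomp g
      have hnr : n ∈ simplexTuples d r :=
        mem_simplexTuples.2 (hn.trans (ham.trans (hlen.trans_le hg)))
      refine ⟨(o, ⟨n, hnr⟩, k), trivial, ?_⟩
      rw [hprod, ← hon] at h
      rw [h] at hk
      exact hk.symm
    refine (Set.ncard_le_ncard hsub (Set.toFinite _)).trans
      ((Set.ncard_image_le Set.finite_univ).trans_eq ?_)
    rw [Set.ncard_univ]
    simp only [Nat.card_prod, Nat.card_eq_fintype_card, Fintype.card_option, Fintype.card_fin,
      Fintype.card_coe, card_simplexTuples]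
    ring

end UpperBound

theorem rk_le_and_torsion_card_le_of_growth_sets_subset
    {G : Type*} {G' : Type*} [CommGroup G] [CommGroup G'] (hG : Group.FG G) (hG' : Group.FG G')
    (h : {f : ℕ → ℕ | ∃ S : Set G, S.Finite ∧ IsMonGenSet S ∧ growth S = f}
       ⊆ {f : ℕ → ℕ | ∃ S' : Set G', S'.Finite ∧ IsMonGenSet S' ∧ growth S' = f}) :
    rk G' ≤ rk G ∧ (rk G' = rk G →
      Nat.card (CommGroup.torsion G') ≤ Nat.card (CommGroup.torsion G)) := by
  obtain ⟨p, hp, hK, hfin⟩ := exists_hom_int_pi hG (rk G) rfl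
  obtain ⟨p', hp', hK', hfin'⟩ := exists_hom_int_pi hG' (rk G') rfl
  obtain ⟨S, hSfin, hS, hupper⟩ := exists_growth_le hp _ fun g => (hK g).1
  obtain ⟨S', hSfin', hS', heq⟩ := h ⟨S, hSfin, hS, rfl⟩
  obtain ⟨c, hlower⟩ := hS'.exists_le_growth hSfin' hp' _ fun g => (hK' g).2
  have hcomp := le_of_forall_mul_choose_le (c := c)
    (Nat.mul_pos (Nat.card_pos (α := CommGroup.torsion G')) (Nat.succ_pos (rk G')))
    fun r => (hlower r).trans (heq ▸ hupper (r + c))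
  refine ⟨hcomp.1, fun hrk => ?_⟩
  have := hcomp.2 hrk
  rw [hrk] at this
  exact Nat.le_of_mul_le_mul_right this (Nat.succ_pos _)

/-- If two finitely generated Abelian groups have the same set of growth functions
with respect to finite monoid generating sets, then they have the same rank and
torsion parts of the same size. -/
theorem rank_and_torsion_card_eq_of_growth_sets_eq
    (G G' : Type*) [CommGroup G] [CommGroup G'] (hG : Group.FG G) (hG' : Group.FG G')
    (h : {f : ℕ → ℕ | ∃ S : Set G, S.Finite ∧ IsMonGenSet S ∧ growth S = f}
       = {f : ℕ → ℕ | ∃ S' : Set G', S'.Finite ∧ IsMonGenSet S' ∧ growth S' = f}) :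
    rk G = rk G' ∧ Nat.card (CommGroup.torsion G) = Nat.card (CommGroup.torsion G') := by
  obtain ⟨h1, h2⟩ := rk_le_and_torsion_card_le_of_growth_sets_subset hG hG' h.subset
  obtain ⟨h3, h4⟩ := rk_le_and_torsion_card_le_of_growth_sets_subset hG' hG h.superset
  have hrk := le_antisymm h3 h1
  exact ⟨hrk, le_antisymm (h4 hrk) (h2 hrk.symm)⟩
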